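/- Let κ > 1, set ρ = (√(κ+1) − 1)/(√(κ+1) + 1), let Φ ∈ ℝ, and let (s_j)_{j≥0} be reals with s₀ = 0 and |s_j − Φ| ≤ 2(√(κ+1)+1) log(2κ) ρ^{2j} for all j ≥ 0. Let 1 ≤ i₁ < i₂ be integers and let p be the Γ-optimal distribution p(i) = ρ^{2i} / ∑_{l=i₁}^{i₂} ρ^{2l} on {i₁, …, i₂}. Then the variance of the TSS-LogQF estimator satisfies ∑_{j=i₁}^{i₂} p(j) ( (s_j − s_{j−1})/p(j) + s_{i₁−1} − s_{i₂} )² ≤ ( (√(κ+1)+1)⁶ log²(2κ) / (κ+1) ) · ρ^{4(i₁−1)} ( ρ^{2(i₂−i₁+1)} − 1 )². -/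

import Mathlib

/-- The variance of an importance-sampling estimator is at most its second moment. -/
theorem sum_mul_div_sub_sum_sq_le {ι : Type*} (I : Finset ι) (p d : ι → ℝ)
    (hp : ∀ i ∈ I, p i ≠ 0) (hp1 : ∑ i ∈ I, p i = 1) :
    ∑ i ∈ I, p i * (d i / p i - ∑ l ∈ I, d l) ^ 2 ≤ ∑ i ∈ I, d i ^ 2 / p i := by
  set D := ∑ l ∈ I, d l with hD
  have h : ∀ i ∈ I, p i * (d i / p i - D) ^ 2 = d i ^ 2 / p i - 2 * D * d i + D ^ 2 * p i := by
    intro i hi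
    have := hp i hi
    field_simp
    ring
  rw [Finset.sum_congr rfl h, Finset.sum_add_distrib, Finset.sum_sub_distrib,
    ← Finset.mul_sum, ← Finset.mul_sum, hp1, ← hD]
  nlinarith [sq_nonneg D]

theorem sum_Icc_sub_pred (s : ℕ → ℝ) {a b : ℕ} (hab : a ≤ b) :
    ∑ j ∈ Finset.Icc a b, (s j - s (j - 1)) = s b - s (a - 1) := by
  induction b, hab using Nat.le_induction with
  | base => simp
  | succ n hn ih =>
    rw [Finset.sum_Icc_succ_top (by lia), ih]
    simp

theorem sum_Icc_pow_mul_one_sub (q : ℝ) {a b : ℕ} (hab : a ≤ b) :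
    (∑ j ∈ Finset.Icc a b, q ^ j) * (1 - q) = q ^ a * (1 - q ^ (b - a + 1)) := by
  induction b, hab using Nat.le_induction with
  | base => simp
  | succ n hn ih =>
    rw [Finset.sum_Icc_succ_top (by lia), add_mul, ih]
    obtain ⟨m, rfl⟩ := Nat.exists_eq_add_of_le hn
    rw [show a + m + 1 - a + 1 = m + 2 by lia, show a + m - a + 1 = m + 1 by lia]
    ring

/-- Second-moment bound for the geometric sampling distribution, when the sequence converges
geometrically with the same rate. -/
theorem sum_sq_div_geometric_le {q C Φ : ℝ} (hq0 : 0 < q) (hq1 : q ≤ 1) {s : ℕ → ℝ}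
    (hs : ∀ j, |s j - Φ| ≤ C * q ^ j) {a b : ℕ} (ha : 1 ≤ a) :
    ∑ j ∈ Finset.Icc a b, (s j - s (j - 1)) ^ 2 / (q ^ j / ∑ l ∈ Finset.Icc a b, q ^ l)
      ≤ 4 * C ^ 2 * ((∑ l ∈ Finset.Icc a b, q ^ l) / q) ^ 2 := by
  set S := ∑ l ∈ Finset.Icc a b, q ^ l with hS
  have hS0 : 0 ≤ S := Finset.sum_nonneg fun l _ => by positivity
  have hC : 0 ≤ C := by simpa using (abs_nonneg _).trans (hs 0)
  have h : ∀ j ∈ Finset.Icc a b,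
      (s j - s (j - 1)) ^ 2 / (q ^ j / S) ≤ 4 * C ^ 2 * (S / q ^ 2) * q ^ j := by
    intro j hj
    obtain ⟨k, rfl⟩ : ∃ k, j = k + 1 := ⟨j - 1, by have := (Finset.mem_Icc.1 hj).1; lia⟩
    rw [Nat.add_sub_cancel]
    have hd : |s (k + 1) - s k| ≤ 2 * C * q ^ k := by
      have h1 := abs_sub_le (s (k + 1)) Φ (s k)
      rw [abs_sub_comm Φ] at h1
      have h2 : C * q ^ (k + 1) ≤ C * q ^ k :=
        mul_le_mul_of_nonneg_left (pow_le_pow_of_le_one hq0.le hq1 k.le_succ) hC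
      linarith [hs k, hs (k + 1)]
    have hd2 := sq_le_sq' (abs_le.1 hd).1 (abs_le.1 hd).2
    calc (s (k + 1) - s k) ^ 2 / (q ^ (k + 1) / S)
        ≤ (2 * C * q ^ k) ^ 2 / (q ^ (k + 1) / S) := by gcongr
      _ = 4 * C ^ 2 * (S / q ^ 2) * q ^ (k + 1) := by
        rcases hS0.eq_or_lt with h0 | h0
        · simp [← h0]
        · field_simp
          ring
  calc _ ≤ ∑ j ∈ Finset.Icc a b, 4 * C ^ 2 * (S / q ^ 2) * q ^ j := Finset.sum_le_sum h
    _ = 4 * C ^ 2 * (S / q) ^ 2 := by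
      rw [← Finset.mul_sum, ← hS]
      ring

/-- Variance bound for the TSS-LogQF estimator under the Γ-optimal
sampling distribution. -/
theorem tss_logqf_variance_optimal
    (κ : ℝ) (hκ : 1 < κ)
    (ρ : ℝ) (hρ : ρ = (Real.sqrt (κ + 1) - 1) / (Real.sqrt (κ + 1) + 1))
    (Φ : ℝ) (s : ℕ → ℝ) (hs0 : s 0 = 0)
    (hbound : ∀ j : ℕ,
      |s j - Φ| ≤ 2 * (Real.sqrt (κ + 1) + 1) * Real.log (2 * κ) * ρ ^ (2 * j))
    (i1 i2 : ℕ) (h1 : 1 ≤ i1) (h2 : i1 < i2)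
    (p : ℕ → ℝ)
    (hpdef : ∀ i, p i = ρ ^ (2 * i) / ∑ l ∈ Finset.Icc i1 i2, ρ ^ (2 * l)) :
    ∑ j ∈ Finset.Icc i1 i2,
        p j * ((s j - s (j - 1)) / p j + s (i1 - 1) - s i2) ^ 2
      ≤ (Real.sqrt (κ + 1) + 1) ^ 6 * Real.log (2 * κ) ^ 2 / (κ + 1) *
        (ρ ^ (4 * (i1 - 1)) * (ρ ^ (2 * (i2 - i1 + 1)) - 1) ^ 2) := by
  have ht : 1 < √(κ + 1) := Real.lt_sqrt_of_sq_lt (by linarith)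
  have hsq : √(κ + 1) ^ 2 = κ + 1 := Real.sq_sqrt (by linarith)
  rw [← hsq, Real.sqrt_sq (by positivity)]
  set t := √(κ + 1)
  set L := Real.log (2 * κ)
  have hρ0 : 0 < ρ := hρ ▸ div_pos (by linarith) (by linarith)
  have hq : 1 - ρ ^ 2 = 4 * t / (t + 1) ^ 2 := by
    rw [hρ]
    field_simp
    ring
  have hq_pos : 0 < 1 - ρ ^ 2 := hq ▸ by positivity
  simp only [pow_mul ρ 2] at hbound hpdef ⊢
  rw [show ρ ^ (4 * (i1 - 1)) = ((ρ ^ 2) ^ (i1 - 1)) ^ 2 by ring]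
  set q := ρ ^ 2
  have hq0 : 0 < q := by positivity
  have hS_pos : 0 < ∑ l ∈ Finset.Icc i1 i2, q ^ l :=
    Finset.sum_pos (fun _ _ => by positivity) (Finset.nonempty_Icc.2 h2.le)
  have hp1 : ∑ i ∈ Finset.Icc i1 i2, p i = 1 := by
    simp only [hpdef, ← Finset.sum_div]
    exact div_self hS_pos.ne'
  have hvar := sum_mul_div_sub_sum_sq_le (Finset.Icc i1 i2) p (fun j => s j - s (j - 1))
    (fun i _ => by rw [hpdef]; positivity) hp1
  have hmom := sum_sq_div_geometric_le hq0 (by linarith) hbound (b := i2) h1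
  simp only [← hpdef] at hmom
  simp only [sum_Icc_sub_pred s h2.le, sub_sub_eq_add_sub] at hvar
  have hS : (∑ l ∈ Finset.Icc i1 i2, q ^ l) / q
      = q ^ (i1 - 1) * (1 - q ^ (i2 - i1 + 1)) / (1 - q) := by
    rw [div_eq_div_iff hq0.ne' hq_pos.ne', sum_Icc_pow_mul_one_sub q h2.le,
      ← pow_sub_one_mul (by lia : i1 ≠ 0) q]
    ring
  refine (hvar.trans hmom).trans_eq ?_
  rw [hS, hq]
  field_simp
  ring
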